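/- Let n ≥ 1 be an integer. For every pair of subsets A ⊆ B ⊆ {1,…,n} with |B| = |A| + 1, let c_{A,B} be a nonzero complex number, and assume the cocycle condition: for all subsets A ⊆ C with |C| = |A| + 2, the sum of c_{A,B}·c_{B,C} over all B with A ⊆ B ⊆ C and |B| = |A| + 1 equals 0. For 0 ≤ i ≤ n let F_i be the complex vector space of functions from the i-element subsets of {1,…,n} to ℂ, and define d_i : F_i → F_{i+1} by (d_i x)(B) = Σ_{A ⊆ B, |A| = |B|−1} c_{A,B}·x(A) (the cocycle condition guarantees d_{i+1} ∘ d_i = 0). Then the complex 0 → F_0 → F_1 → … → F_n → 0 is exact: d_0 is injective, d_{n−1} is surjective, and ker d_i = im d_{i−1} for all 0 < i < n. -/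

import Mathlib

open Finset

/-- `F_i`: the space of complex-valued functions on the `i`-element subsets of `{1, …, n}`. -/
abbrev cochain (n i : ℕ) : Type := {A : Finset (Fin n) // A.card = i} → ℂ

/-- The differential `d_i : F_i → F_{i+1}`,
`(d_i x)(B) = Σ_{A ⊆ B, |A| = |B| − 1} c_{A,B} · x(A)`. -/
noncomputable def diff (n : ℕ) (c : Finset (Fin n) → Finset (Fin n) → ℂ) (i : ℕ)
    (x : cochain n i) : cochain n (i + 1) :=
  fun B => ∑ A : {A : Finset (Fin n) // A.card = i},
    if A.1 ⊆ B.1 then c A.1 B.1 * x A else 0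

/-- The total differential on functions defined on all subsets of `{1, …, n}`. -/
noncomputable def totalDiff {n : ℕ} (c : Finset (Fin n) → Finset (Fin n) → ℂ)
    (f : Finset (Fin n) → ℂ) (B : Finset (Fin n)) : ℂ :=
  ∑ b ∈ B, c (B.erase b) B * f (B.erase b)

/-- The contracting homotopy of the total complex in the direction of the element `e`. -/
noncomputable def homotopy {n : ℕ} (c : Finset (Fin n) → Finset (Fin n) → ℂ) (e : Fin n)
    (f : Finset (Fin n) → ℂ) (A : Finset (Fin n)) : ℂ :=
  if e ∈ A then 0 else (c A (insert e A))⁻¹ * f (insert e A)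

lemma diff_restrict {n : ℕ} (c : Finset (Fin n) → Finset (Fin n) → ℂ) (i : ℕ)
    (f : Finset (Fin n) → ℂ) (B : {B : Finset (Fin n) // B.card = i + 1}) :
    diff n c i (fun A => f A.1) B = totalDiff c f B.1 := by
  obtain ⟨B, hB⟩ := B
  simp only [diff, totalDiff]
  rw [← Finset.sum_filter]
  symm
  refine Finset.sum_bij (fun b hb => ⟨B.erase b, by rw [card_erase_of_mem hb, hB]; rfl⟩)
    ?_ ?_ ?_ ?_
  · intro b hb
    simp [erase_subset]
  · intro b hb b' hb' h
    exact (Finset.erase_injOn B) hb hb' (congrArg Subtype.val h)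
  · rintro ⟨A, hA⟩ h
    have hAB : A ⊆ B := (mem_filter.mp h).2
    obtain ⟨b, hb, rfl⟩ := (Finset.exists_eq_insert_iff (s := A) (t := B)).mpr ⟨hAB, by omega⟩
    exact ⟨b, mem_insert_self _ _, by simp [erase_insert hb]⟩
  · intro b hb
    rfl

lemma exists_restrict_eq {n i : ℕ} (x : cochain n i) :
    ∃ f : Finset (Fin n) → ℂ, (fun A : {A : Finset (Fin n) // A.card = i} => f A.1) = x :=
  ⟨fun A => if h : A.card = i then x ⟨A, h⟩ else 0, by
    funext A
    simp [A.2]⟩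

lemma cocycle_insert {n : ℕ} {c : Finset (Fin n) → Finset (Fin n) → ℂ}
    (hcoc : ∀ A C : Finset (Fin n), A ⊆ C → C.card = A.card + 2 →
      ∑ B ∈ C.powerset.filter (fun B => A ⊆ B ∧ B.card = A.card + 1),
        c A B * c B C = 0)
    {A : Finset (Fin n)} {b e : Fin n} (hb : b ∉ A) (he : e ∉ A) (hbe : b ≠ e) :
    c A (insert b A) * c (insert b A) (insert e (insert b A)) +
      c A (insert e A) * c (insert e A) (insert e (insert b A)) = 0 := by
  have hcard : (insert e (insert b A)).card = A.card + 2 := by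
    rw [card_insert_of_notMem (by simp [he, hbe.symm]), card_insert_of_notMem hb]
  have hsub : A ⊆ insert e (insert b A) :=
    (subset_insert _ _).trans (subset_insert _ _)
  have hfilter : (insert e (insert b A)).powerset.filter
      (fun B => A ⊆ B ∧ B.card = A.card + 1) = {insert b A, insert e A} := by
    ext B
    simp only [mem_filter, mem_powerset, mem_insert, mem_singleton]
    constructor
    · rintro ⟨hBC, hAB, hB⟩
      obtain ⟨x, hx, rfl⟩ := (Finset.exists_eq_insert_iff (s := A) (t := B)).mpr ⟨hAB, hB.symm⟩
      have := hBC (mem_insert_self x A)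
      simp only [mem_insert, hx, or_false] at this
      rcases this with rfl | rfl <;> simp
    · rintro (rfl | rfl)
      · exact ⟨subset_insert _ _, subset_insert _ _, card_insert_of_notMem hb⟩
      · exact ⟨insert_subset_insert _ (subset_insert _ _), subset_insert _ _,
          card_insert_of_notMem he⟩
  have hne : insert b A ≠ insert e A := by
    intro h
    have : b ∈ insert e A := h ▸ mem_insert_self b A
    simp [hb, hbe] at this
  have := hcoc A _ hsub hcard
  rwa [hfilter, Finset.sum_pair hne] at this

lemma totalDiff_homotopy_add {n : ℕ} {c : Finset (Fin n) → Finset (Fin n) → ℂ}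
    (hnz : ∀ A B : Finset (Fin n), A ⊆ B → B.card = A.card + 1 → c A B ≠ 0)
    (hcoc : ∀ A C : Finset (Fin n), A ⊆ C → C.card = A.card + 2 →
      ∑ B ∈ C.powerset.filter (fun B => A ⊆ B ∧ B.card = A.card + 1),
        c A B * c B C = 0)
    (e : Fin n) (f : Finset (Fin n) → ℂ) (A : Finset (Fin n)) :
    totalDiff c (homotopy c e f) A + homotopy c e (totalDiff c f) A = f A := by
  have hins : ∀ {A : Finset (Fin n)}, e ∉ A → c A (insert e A) ≠ 0 := fun h =>
    hnz _ _ (subset_insert _ _) (card_insert_of_notMem h)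
  by_cases he : e ∈ A
  · have h0 := hins (notMem_erase e A)
    rw [insert_erase he] at h0
    rw [totalDiff, Finset.sum_eq_single_of_mem e he]
    · simp [homotopy, he, insert_erase he, h0]
    · intro b _ hbe
      simp [homotopy, he, hbe.symm]
  · have h0 := hins he
    simp only [homotopy, he, if_false, totalDiff, sum_insert he, erase_insert he, mul_add,
      Finset.mul_sum]
    rw [inv_mul_cancel_left₀ h0, add_left_comm, ← Finset.sum_add_distrib,
      Finset.sum_eq_zero, add_zero]
    intro b hb
    have hbe : b ≠ e := fun h => he (h ▸ hb)
    have heb : e ∉ A.erase b := fun h => he (mem_of_mem_erase h)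
    have h1 := hins heb
    have key := cocycle_insert hcoc (notMem_erase b A) heb hbe
    rw [insert_erase hb] at key
    rw [if_neg heb, erase_insert_of_ne hbe.symm]
    field_simp
    linear_combination f (insert e (A.erase b)) * key

lemma homotopy_totalDiff_congr {n i : ℕ} {c : Finset (Fin n) → Finset (Fin n) → ℂ} (e : Fin n)
    {f g : Finset (Fin n) → ℂ}
    (h : diff n c i (fun A => f A.1) = diff n c i (fun A => g A.1))
    {A : Finset (Fin n)} (hA : A.card = i) :
    homotopy c e (totalDiff c f) A = homotopy c e (totalDiff c g) A := by
  by_cases he : e ∈ A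
  · simp [homotopy, he]
  · have := congrFun h ⟨insert e A, by rw [card_insert_of_notMem he, hA]⟩
    rw [diff_restrict, diff_restrict] at this
    simp only [homotopy, he, if_false, this]

lemma diff_diff {n : ℕ} {c : Finset (Fin n) → Finset (Fin n) → ℂ}
    (hcoc : ∀ A C : Finset (Fin n), A ⊆ C → C.card = A.card + 2 →
      ∑ B ∈ C.powerset.filter (fun B => A ⊆ B ∧ B.card = A.card + 1),
        c A B * c B C = 0)
    (i : ℕ) (y : cochain n i) : diff n c (i + 1) (diff n c i y) = 0 := by
  funext ⟨C, hC⟩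
  have hswap : diff n c (i + 1) (diff n c i y) ⟨C, hC⟩ =
      ∑ A : {A : Finset (Fin n) // A.card = i},
        (∑ B : {B : Finset (Fin n) // B.card = i + 1},
          if A.1 ⊆ B.1 ∧ B.1 ⊆ C then c A.1 B.1 * c B.1 C else 0) * y A := by
    simp only [diff, Finset.sum_mul]
    rw [Finset.sum_comm]
    refine Finset.sum_congr rfl fun B _ => ?_
    by_cases hB : B.1 ⊆ C
    · simp only [hB, if_true, and_true, Finset.mul_sum]
      refine Finset.sum_congr rfl fun A _ => ?_
      split_ifs <;> ring
    · simp [hB]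
  rw [hswap]
  refine Finset.sum_eq_zero fun ⟨A, hA⟩ _ => ?_
  refine mul_eq_zero_of_left ?_ _
  by_cases hAC : A ⊆ C
  · rw [← Finset.sum_filter]
    refine Eq.trans ?_ (hcoc A C hAC (by omega))
    refine Finset.sum_bij (fun B _ => B.1) ?_ ?_ ?_ ?_
    · intro B hB
      have := (mem_filter.mp hB).2
      exact mem_filter.mpr ⟨mem_powerset.mpr this.2, this.1, by rw [B.2, hA]⟩
    · exact fun _ _ _ _ h => Subtype.ext h
    · intro B hB
      obtain ⟨h1, h2, h3⟩ := mem_filter.mp hB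
      exact ⟨⟨B, by rw [h3, hA]⟩, mem_filter.mpr ⟨mem_univ _, h2, mem_powerset.mp h1⟩, rfl⟩
    · exact fun _ _ => rfl
  · exact Finset.sum_eq_zero fun B _ => if_neg fun h => hAC (h.1.trans h.2)

/-- For nonzero scalars `c_{A,B}` (for `A ⊆ B`, `|B| = |A| + 1`) satisfying the cocycle
condition, the complex `0 → F_0 → F_1 → … → F_n → 0` is exact: `d_0` is injective,
`d_{n−1}` is surjective, and `ker d_{i+1} = im d_i` in the middle. -/
theorem cube_complex_exact (n : ℕ) (hn : 1 ≤ n)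
    (c : Finset (Fin n) → Finset (Fin n) → ℂ)
    (hnz : ∀ A B : Finset (Fin n), A ⊆ B → B.card = A.card + 1 → c A B ≠ 0)
    (hcoc : ∀ A C : Finset (Fin n), A ⊆ C → C.card = A.card + 2 →
      ∑ B ∈ C.powerset.filter (fun B => A ⊆ B ∧ B.card = A.card + 1),
        c A B * c B C = 0) :
    Function.Injective (diff n c 0) ∧
    Function.Surjective (diff n c (n - 1)) ∧
    ∀ i : ℕ, i + 1 < n → ∀ x : cochain n (i + 1),
      diff n c (i + 1) x = 0 ↔ ∃ y : cochain n i, diff n c i y = x := by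
  have hom := fun f A => totalDiff_homotopy_add hnz hcoc ⟨0, hn⟩ f A
  refine ⟨fun x y hxy => ?_, fun x => ?_, fun i _ x => ⟨fun hx => ?_, ?_⟩⟩
  · obtain ⟨f, rfl⟩ := exists_restrict_eq x
    obtain ⟨g, rfl⟩ := exists_restrict_eq y
    funext ⟨A, hA⟩
    have h := homotopy_totalDiff_congr ⟨0, hn⟩ hxy hA
    obtain rfl := card_eq_zero.mp hA
    have hf := hom f ∅
    have hg := hom g ∅
    rw [totalDiff, sum_empty, zero_add] at hf hg
    change f ∅ = g ∅
    rw [← hf, ← hg, h]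
  · obtain ⟨f, rfl⟩ := exists_restrict_eq x
    refine ⟨fun A => homotopy c ⟨0, hn⟩ f A.1, ?_⟩
    funext ⟨B, hB⟩
    have hBu : B = univ := card_eq_iff_eq_univ B |>.mp (by rw [Fintype.card_fin]; omega)
    have h := hom f B
    rw [diff_restrict]
    rw [homotopy, if_pos (hBu ▸ mem_univ _), add_zero] at h
    exact h
  · obtain ⟨f, rfl⟩ := exists_restrict_eq x
    refine ⟨fun A => homotopy c ⟨0, hn⟩ f A.1, ?_⟩
    funext ⟨B, hB⟩
    have hzero : diff n c (i + 1) (fun A => (0 : Finset (Fin n) → ℂ) A.1) = 0 := by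
      funext B
      simp [diff]
    have h := hom f B
    rw [homotopy_totalDiff_congr ⟨0, hn⟩ (hx.trans hzero.symm) hB] at h
    rw [diff_restrict]
    simpa [homotopy, totalDiff] using h
  · rintro ⟨y, rfl⟩
    exact diff_diff hcoc i y
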